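/- Let (X, π) be a weighted simplicial complex of rank n and let 0 ≤ ℓ ≤ n−1. Then Gap(Duw_{n↔ℓ}) ≥ ((n−ℓ)/n) · min over all chains ∅ = ω^(0) ⊊ ω^(1) ⊊ ⋯ ⊊ ω^(ℓ−1) with ω^(i) ∈ X^(i) of the product ∏_{i=0}^{ℓ−1} Gap(M_{ω^(i)}). In particular, writing Gap_i(X, π) = min_{ω̂ ∈ X^(i)} Gap(M_ω̂), one has Gap(Duw_{n↔ℓ}) ≥ ((n−ℓ)/n) · ∏_{i=0}^{ℓ−1} Gap_i(X, π). -/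

import Mathlib

open scoped Classical
noncomputable section

namespace Expanderized

/-! ## Generic weighted linear algebra over finite types -/

section Generic

variable {α β γ : Type*}

/-- Inner product `⟨f,g⟩_μ = E_{x∼μ}[f(x)g(x)]` with respect to a weight `μ`. -/
def inner' [Fintype α] (μ : α → ℝ) (f g : α → ℝ) : ℝ := ∑ x, μ x * (f x * g x)

/-- Expectation with respect to `μ`. -/
def expect [Fintype α] (μ : α → ℝ) (f : α → ℝ) : ℝ := ∑ x, μ x * f x

/-- `μ` is a probability distribution. -/
def IsProbDist [Fintype α] (μ : α → ℝ) : Prop := (∀ x, 0 ≤ μ x) ∧ (∑ x, μ x) = 1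

/-- A row-stochastic kernel. -/
def IsRowStochastic [Fintype β] (P : α → β → ℝ) : Prop :=
  (∀ x y, 0 ≤ P x y) ∧ ∀ x, (∑ y, P x y) = 1

/-- Product of two kernels (matrix multiplication). -/
def matMul [Fintype β] (A : α → β → ℝ) (B : β → γ → ℝ) : α → γ → ℝ :=
  fun x z => ∑ y, A x y * B y z

/-- Right action of a kernel on a function (column vector). -/
def mApp [Fintype β] (A : α → β → ℝ) (f : β → ℝ) : α → ℝ :=
  fun x => ∑ y, A x y * f y

/-- Left action of a kernel on a row vector / measure. -/
def rowMul [Fintype α] (μ : α → ℝ) (A : α → β → ℝ) : β → ℝ :=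
  fun y => ∑ x, μ x * A x y

/-- The adjoint of the kernel `P` with respect to the measures `(μ₁, μ₂)`. -/
def adjointKer [Fintype α] [Fintype β] (μ₁ : α → ℝ) (μ₂ : β → ℝ) (P : α → β → ℝ) :
    β → α → ℝ :=
  fun y x => P x y * μ₁ x / μ₂ y

/-- Iterates of a square kernel. -/
def matIter [Fintype α] [DecidableEq α] (A : α → α → ℝ) : ℕ → (α → α → ℝ)
  | 0 => fun x y => if x = y then 1 else 0
  | (t + 1) => matMul (matIter A t) A

/-- The second-largest eigenvalue `λ₂` of a random walk matrix that is reversible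
with respect to `μ`, via its Rayleigh-quotient (Courant–Fischer) characterization. -/
def lambda2 [Fintype α] (μ : α → ℝ) (A : α → α → ℝ) : ℝ :=
  sSup {r | ∃ f : α → ℝ, inner' μ f f = 1 ∧ inner' μ f (fun _ => 1) = 0 ∧
      r = inner' μ f (mApp A f)}

/-- The spectral gap `1 - λ₂`. -/
def specGap [Fintype α] (μ : α → ℝ) (A : α → α → ℝ) : ℝ := 1 - lambda2 μ A

/-- The two-sided expansion `λ(A) = max(λ₂(A), |λ_min(A)|)` of a random walk matrix
reversible with respect to `μ`, via its Rayleigh-quotient characterization. -/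
def twoSided [Fintype α] (μ : α → ℝ) (A : α → α → ℝ) : ℝ :=
  sSup {r | ∃ f : α → ℝ, inner' μ f f = 1 ∧ inner' μ f (fun _ => 1) = 0 ∧
      r = |inner' μ f (mApp A f)|}

/-- The operator norm `‖A‖_{op,μ}`. -/
def opNorm [Fintype α] (μ : α → ℝ) (A : α → α → ℝ) : ℝ :=
  sSup {r | ∃ f : α → ℝ, inner' μ f f = 1 ∧
      r = Real.sqrt (inner' μ (mApp A f) (mApp A f))}

/-- The `Φ`-entropy functional `Ent^Φ_μ(f) = E_μ[Φ(f)] - Φ(E_μ f)`. -/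
def phiEnt [Fintype α] (Φ : ℝ → ℝ) (μ : α → ℝ) (f : α → ℝ) : ℝ :=
  expect μ (fun x => Φ (f x)) - Φ (expect μ f)

/-- `t ↦ t log t`; note `Real.log 0 = 0`, so the convention `0 log 0 = 0` is built in. -/
def nlog (t : ℝ) : ℝ := t * Real.log t

/-- The usual entropy functional `Ent_μ`. -/
def ent [Fintype α] (μ : α → ℝ) (f : α → ℝ) : ℝ := phiEnt nlog μ f

/-- The `Φ`-entropy contraction constant of a kernel `P` with respect to measures
`(μ₁, μ₂)`: the largest `C ≥ 0` such that `Ent^Φ_{μ₁}(Pf) ≤ (1-C)·Ent^Φ_{μ₂}(f)`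
for all nonnegative `f`. -/
def CFphi [Fintype α] [Fintype β] (Φ : ℝ → ℝ) (μ₁ : α → ℝ) (μ₂ : β → ℝ)
    (P : α → β → ℝ) : ℝ :=
  sSup {C | 0 ≤ C ∧ ∀ f : β → ℝ, (∀ y, 0 ≤ f y) →
      phiEnt Φ μ₁ (mApp P f) ≤ (1 - C) * phiEnt Φ μ₂ f}

/-- The entropy contraction constant `EC(P)`. -/
def EC [Fintype α] [Fintype β] (μ₁ : α → ℝ) (μ₂ : β → ℝ) (P : α → β → ℝ) : ℝ :=
  CFphi nlog μ₁ μ₂ P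

/-- The log-Sobolev constant of a reversible kernel `P` with stationary measure `μ`:
the largest `C ≥ 0` with `C·Ent_μ(f²) ≤ ⟨f,(I-P)f⟩_μ` for all nonnegative `f`. -/
def LS [Fintype α] (μ : α → ℝ) (P : α → α → ℝ) : ℝ :=
  sSup {C | 0 ≤ C ∧ ∀ f : α → ℝ, (∀ x, 0 ≤ f x) →
      C * ent μ (fun x => f x ^ 2) ≤ inner' μ f (fun x => f x - mApp P f x)}

/-- The modified log-Sobolev constant of a reversible kernel `P` with stationary
measure `μ`: the largest `C ≥ 0` with `C·Ent_μ(f) ≤ ⟨f,(I-P) log f⟩_μ`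
for all strictly positive `f`. -/
def MLS [Fintype α] (μ : α → ℝ) (P : α → α → ℝ) : ℝ :=
  sSup {C | 0 ≤ C ∧ ∀ f : α → ℝ, (∀ x, 0 < f x) →
      C * ent μ f ≤
        inner' μ f (fun x => Real.log (f x) - mApp P (fun y => Real.log (f y)) x)}

/-- Total variation distance. -/
def tvDist [Fintype α] (μ ν : α → ℝ) : ℝ := (∑ x, |μ x - ν x|) / 2

/-- The `ε`-mixing time of a kernel `P` towards the target distribution `π`. -/
def mixingTime [Fintype α] [DecidableEq α] (P : α → α → ℝ) (π : α → ℝ) (ε : ℝ) : ℕ :=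
  sInf {t : ℕ | ∀ μ₀ : α → ℝ, IsProbDist μ₀ → tvDist (rowMul μ₀ (matIter P t)) π ≤ ε}

end Generic

/-! ## Weighted simplicial complexes -/

/-- A weighted (pure) simplicial complex of rank `n` on a finite vertex set `V`:
a downward-closed collection of faces, all maximal faces of cardinality `n`,
together with a fully supported probability distribution `pi` on the rank `n` faces
(extended by zero to all finsets). -/
structure WComplex (V : Type*) [Fintype V] [DecidableEq V] (n : ℕ) where
  faces : Finset (Finset V)
  pi : Finset V → ℝ
  faces_nonempty : faces.Nonempty
  down_closed : ∀ α ∈ faces, ∀ β ⊆ α, β ∈ faces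
  card_le : ∀ α ∈ faces, α.card ≤ n
  pure : ∀ α ∈ faces, ∃ ω ∈ faces, ω.card = n ∧ α ⊆ ω
  pi_pos : ∀ ω ∈ faces, ω.card = n → 0 < pi ω
  pi_zero_of_not_mem : ∀ ω : Finset V, ω ∉ faces → pi ω = 0
  pi_zero_of_card_ne : ∀ ω : Finset V, ω.card ≠ n → pi ω = 0
  pi_sum : (∑ ω : Finset V, pi ω) = 1

namespace WComplex

variable {V : Type*} [Fintype V] [DecidableEq V] {n : ℕ}

/-- `Pr_{ω∼π}[ω ⊇ α]` (unnormalized level mass of a face). -/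
def mass (K : WComplex V n) (α : Finset V) : ℝ :=
  ∑ ω : Finset V, if α ⊆ ω then K.pi ω else 0

/-- The induced distribution `π_j` on the `j`-th level `X^(j)`. -/
def level (K : WComplex V n) (j : ℕ) : Finset V → ℝ :=
  fun α => if α.card = j then ((n.choose j : ℝ))⁻¹ * K.mass α else 0

/-- The up-walk `Up_{ℓ→k}`. -/
def up (K : WComplex V n) (ℓ k : ℕ) : Finset V → Finset V → ℝ :=
  fun a b =>
    if a.card = ℓ ∧ b.card = k ∧ a ⊆ b then
      (((n - ℓ).choose (k - ℓ) : ℝ))⁻¹ * (K.mass b / K.mass a)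
    else 0

/-- The down-walk `Down_{k→ℓ}`. -/
def down (K : WComplex V n) (k ℓ : ℕ) : Finset V → Finset V → ℝ :=
  fun a b => if a.card = k ∧ b.card = ℓ ∧ b ⊆ a then ((k.choose ℓ : ℝ))⁻¹ else 0

/-- The down-up walk `Duw_{n↔ℓ} = Down_{n→ℓ}·Up_{ℓ→n}` on `X^(n)`. -/
def downUp (K : WComplex V n) (ℓ : ℕ) : Finset V → Finset V → ℝ :=
  matMul (K.down n ℓ) (K.up ℓ n)

/-- The up-down walk `Udw_{ℓ↔n} = Up_{ℓ→n}·Down_{n→ℓ}` on `X^(ℓ)`. -/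
def upDown (K : WComplex V n) (ℓ : ℕ) : Finset V → Finset V → ℝ :=
  matMul (K.up ℓ n) (K.down n ℓ)

/-- The top-level distribution `π^(ω̂)` of the link complex of the face `z`. -/
def linkPi (K : WComplex V n) (z : Finset V) : Finset V → ℝ :=
  fun α => if Disjoint α z then K.pi (z ∪ α) / K.mass z else 0

/-- Unnormalized level mass in the link of `z`. -/
def linkMass (K : WComplex V n) (z α : Finset V) : ℝ :=
  ∑ β : Finset V, if α ⊆ β then K.linkPi z β else 0

/-- The induced distribution `π^(ω̂)_j` on the `j`-th level of the link of `z`. -/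
def linkLevel (K : WComplex V n) (z : Finset V) (j : ℕ) : Finset V → ℝ :=
  fun α => if α.card = j then (((n - z.card).choose j : ℝ))⁻¹ * K.linkMass z α else 0

/-- The up-walk `Up^{ω̂}_{ℓ→k}` of the link complex of `z`. -/
def linkUp (K : WComplex V n) (z : Finset V) (ℓ k : ℕ) : Finset V → Finset V → ℝ :=
  fun a b =>
    if a.card = ℓ ∧ b.card = k ∧ a ⊆ b then
      ((((n - z.card) - ℓ).choose (k - ℓ) : ℝ))⁻¹ * (K.linkMass z b / K.linkMass z a)
    else 0

/-- The vertex marginal `π^(ω̂)_1` of the link of `z`, as a distribution on vertices. -/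
def linkVertex (K : WComplex V n) (z : Finset V) : V → ℝ :=
  fun x => K.linkLevel z 1 {x}

/-- The link random-walk matrix `M_ω̂` of a face `z` (with `|z| ≤ n-2`). -/
def linkMat (K : WComplex V n) (z : Finset V) : V → V → ℝ :=
  fun x y =>
    if x ≠ y then (K.mass (z ∪ {x, y}) / K.mass (z ∪ {x})) / ((n : ℝ) - z.card - 1)
    else 0

/-- The local `Φ`-entropy contraction constant `lc_Φ(ω̂)`: the smallest `c ≥ 0` with
`Ent^Φ_{π^(ω̂)_1}(Up^{ω̂}_{1→n'} g) ≤ c·Ent^Φ_{π^(ω̂)_{n'}}(g)` for all `g ≥ 0`,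
where `n' = n - |ω̂|`. -/
def lcPhi (K : WComplex V n) (Φ : ℝ → ℝ) (z : Finset V) : ℝ :=
  sInf {c | 0 ≤ c ∧ ∀ g : Finset V → ℝ, (∀ x, 0 ≤ g x) →
      phiEnt Φ (K.linkLevel z 1) (mApp (K.linkUp z 1 (n - z.card)) g)
        ≤ c * phiEnt Φ (K.linkLevel z (n - z.card)) g}

/-- The local entropy contraction constant `lec(ω̂)` (the case `Φ(t) = t log t`). -/
def lec (K : WComplex V n) (z : Finset V) : ℝ := K.lcPhi nlog z

end WComplex

/-! ## Partite complexes, auxiliary expander graphs, and expanderized walks -/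

section Partite

variable {n : ℕ} {U : Type*} [Fintype U] [DecidableEq U]

/-- The type of a face of an `n`-partite complex: the set of sides it meets. -/
def typ (α : Finset (Fin n × U)) : Finset (Fin n) := α.image Prod.fst

/-- The restriction `ω_S` of a face to the sides in `S`. -/
def restrict (ω : Finset (Fin n × U)) (S : Finset (Fin n)) : Finset (Fin n × U) :=
  ω.filter fun v => v.1 ∈ S

/-- An `n`-partite complex: every facet contains exactly one vertex from each side. -/
def IsPartite (K : WComplex (Fin n × U) n) : Prop :=
  ∀ ω ∈ K.faces, ω.card = n → (typ ω).card = n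

/-- `H` is a `k`-regular graph all of whose edges join `ℓ`-element subsets of `[n]`. -/
def IsRegularOnSubsets (H : SimpleGraph (Finset (Fin n))) (ℓ k : ℕ) : Prop :=
  (∀ S T, H.Adj S T → S.card = ℓ ∧ T.card = ℓ) ∧
  (∀ S : Finset (Fin n), S.card = ℓ → (Finset.univ.filter fun T => H.Adj S T).card = k)

/-- The simple random walk matrix of a `k`-regular graph `H`. -/
def walkMat (H : SimpleGraph (Finset (Fin n))) (k : ℕ) :
    Finset (Fin n) → Finset (Fin n) → ℝ :=
  fun S T => if H.Adj S T then (k : ℝ)⁻¹ else 0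

/-- The uniform distribution on `ℓ`-element subsets of `[n]`. -/
def unifSubsets (n ℓ : ℕ) : Finset (Fin n) → ℝ :=
  fun S => if S.card = ℓ then ((n.choose ℓ : ℝ))⁻¹ else 0

/-- The two-sided expansion `λ(H)` of `H`. -/
def lamH (H : SimpleGraph (Finset (Fin n))) (ℓ k : ℕ) : ℝ :=
  twoSided (unifSubsets n ℓ) (walkMat H k)

/-- The two-sided expansion `λ(H²)` of the square of `H` (i.e. of the graph whose
random walk matrix is the square of that of `H`). -/
def lamHsq (H : SimpleGraph (Finset (Fin n))) (ℓ k : ℕ) : ℝ :=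
  twoSided (unifSubsets n ℓ) (matMul (walkMat H k) (walkMat H k))

/-- `Pr_{ω∼π}[ω_{typ a} = a ∧ ω_{typ b} = b]`. -/
def jointMass (K : WComplex (Fin n × U) n) (a b : Finset (Fin n × U)) : ℝ :=
  ∑ ω : Finset (Fin n × U),
    if restrict ω (typ a) = a ∧ restrict ω (typ b) = b then K.pi ω else 0

/-- The expanderized up-down walk with type-transition matrix `W`; taking
`W = walkMat H k` gives `UpDown(X, π, H)`, and taking `W = (walkMat H k)²`
gives `UpDown(X, π, H²)`.  Its `(ω̂, ω̃)` entry is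
`W(typ ω̂, typ ω̃) · Pr_{ω∼π}[ω_{typ ω̃} = ω̃ ∣ ω_{typ ω̂} = ω̂]`. -/
def expUpDown (K : WComplex (Fin n × U) n)
    (W : Finset (Fin n) → Finset (Fin n) → ℝ) :
    Finset (Fin n × U) → Finset (Fin n × U) → ℝ :=
  fun a b => W (typ a) (typ b) * (jointMass K a b / jointMass K a a)

/-- The expanderized down-walk `Qdo` from `X^(n) × binom([n],ℓ)` to `X^(ℓ)`. -/
def Qdown (K : WComplex (Fin n × U) n) (H : SimpleGraph (Finset (Fin n))) (k : ℕ) :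
    Finset (Fin n × U) × Finset (Fin n) → Finset (Fin n × U) → ℝ :=
  fun p b => if H.Adj p.2 (typ b) ∧ b ⊆ p.1 then (k : ℝ)⁻¹ else 0

/-- The expanderized up-walk `Qup` from `X^(ℓ)` to `X^(n) × binom([n],ℓ)`
(the adjoint of `Qdown` with respect to `(π_n ⊗ Unif, π_ℓ)`). -/
def Qup (K : WComplex (Fin n × U) n) (H : SimpleGraph (Finset (Fin n))) (k : ℕ) :
    Finset (Fin n × U) → Finset (Fin n × U) × Finset (Fin n) → ℝ :=
  fun b p =>
    (if H.Adj p.2 (typ b) then (k : ℝ)⁻¹ else 0) *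
      ((if b ⊆ p.1 then K.pi p.1 else 0) / K.mass b)

/-- The expanderized down-up walk `Paqx = Qdo·Qup` on `X^(n) × binom([n],ℓ)`. -/
def expDownUp (K : WComplex (Fin n × U) n) (H : SimpleGraph (Finset (Fin n))) (k : ℕ) :
    Finset (Fin n × U) × Finset (Fin n) → Finset (Fin n × U) × Finset (Fin n) → ℝ :=
  matMul (Qdown K H k) (Qup K H k)

/-- The product distribution `π_n ⊗ Unif_{binom([n],ℓ)}`. -/
def prodDist (K : WComplex (Fin n × U) n) (ℓ : ℕ) :
    Finset (Fin n × U) × Finset (Fin n) → ℝ :=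
  fun p => K.pi p.1 * unifSubsets n ℓ p.2

end Partite

/-! ## List colorings -/

section Coloring

variable {n : ℕ} {Col : Type*} [Fintype Col] [DecidableEq Col]

/-- The degree of a vertex in a graph. -/
def degree' {W : Type*} [Fintype W] (G : SimpleGraph W) (v : W) : ℕ :=
  (Finset.univ.filter fun u => G.Adj v u).card

/-- A proper list coloring of `(G, L)`. -/
def IsProperColoring (G : SimpleGraph (Fin n)) (L : Fin n → Finset Col)
    (c : Fin n → Col) : Prop :=
  (∀ v, c v ∈ L v) ∧ ∀ u v, G.Adj u v → c u ≠ c v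

/-- The face `{(v, c v) : v}` associated to a coloring `c`. -/
def colorFace (c : Fin n → Col) : Finset (Fin n × Col) :=
  Finset.univ.image fun v => (v, c v)

/-- `Y` is the list-coloring complex of `(G, L)`: its faces are the subsets of proper
list colorings and its weight is the uniform distribution on proper list colorings. -/
def IsColoringComplex (G : SimpleGraph (Fin n)) (L : Fin n → Finset Col)
    (Y : WComplex (Fin n × Col) n) : Prop :=
  (∀ α : Finset (Fin n × Col),
      α ∈ Y.faces ↔ ∃ c : Fin n → Col, IsProperColoring G L c ∧ α ⊆ colorFace c) ∧
  (∀ ω : Finset (Fin n × Col),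
      Y.pi ω =
        ∑ c : Fin n → Col,
          if IsProperColoring G L c ∧ ω = colorFace c then
            ((Finset.univ.filter fun c' : Fin n → Col =>
                IsProperColoring G L c').card : ℝ)⁻¹
          else 0)

end Coloring

/-! ## Ising models -/

section Ising

variable {n : ℕ}

/-- `±1` value of a Boolean spin. -/
def signR (b : Bool) : ℝ := if b then 1 else -1

/-- The (unnormalized) Ising weight `exp(½⟨x,Jx⟩ + ⟨h,x⟩)`. -/
def isingWeight (J : Matrix (Fin n) (Fin n) ℝ) (h : Fin n → ℝ) (x : Fin n → Bool) : ℝ :=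
  Real.exp ((1 / 2) * (∑ i, ∑ j, J i j * (signR (x i) * signR (x j))) +
    ∑ i, h i * signR (x i))

/-- The face `{(i, x i) : i}` associated to a spin configuration `x`. -/
def spinFace (x : Fin n → Bool) : Finset (Fin n × Bool) :=
  Finset.univ.image fun i => (i, x i)

/-- `Y` is the Ising complex of `(J, h)`. -/
def IsIsingComplex (J : Matrix (Fin n) (Fin n) ℝ) (h : Fin n → ℝ)
    (Y : WComplex (Fin n × Bool) n) : Prop :=
  (∀ α : Finset (Fin n × Bool), α ∈ Y.faces ↔ ∃ x : Fin n → Bool, α ⊆ spinFace x) ∧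
  (∀ ω : Finset (Fin n × Bool),
      Y.pi ω =
        (∑ x : Fin n → Bool, if ω = spinFace x then isingWeight J h x else 0) /
          ∑ x : Fin n → Bool, isingWeight J h x)

/-- The `ℓ₂ → ℓ₂` operator norm of a square matrix. -/
def matOpNorm {m : ℕ} (J : Matrix (Fin m) (Fin m) ℝ) : ℝ :=
  sSup {r | ∃ v : Fin m → ℝ, (∑ i, v i ^ 2) = 1 ∧
      r = Real.sqrt (∑ i, (J.mulVec v i) ^ 2)}

/-- The `2×2` principal submatrix of `J` at rows/columns `i, j`. -/
def principal2 (J : Matrix (Fin n) (Fin n) ℝ) (i j : Fin n) : Matrix (Fin 2) (Fin 2) ℝ :=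
  !![J i i, J i j; J j i, J j j]

/-- `‖h‖_∞`. -/
def normInf (h : Fin n → ℝ) : ℝ := sSup (Set.range fun i => |h i|)

/-- `‖h‖_₁`. -/
def norm1 (h : Fin n → ℝ) : ℝ := ∑ i, |h i|

end Ising

end Expanderized

namespace Expanderized

section UpSum

variable {V : Type*} [Fintype V] [DecidableEq V]

/-- The sum of `h` over all supersets of `z`. -/
def upSum (h : Finset V → ℝ) (z : Finset V) : ℝ :=
  ∑ ω : Finset V, if z ⊆ ω then h ω else 0

theorem upSum_congr {h h' : Finset V → ℝ} {z : Finset V} (H : ∀ ω, z ⊆ ω → h ω = h' ω) :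
    upSum h z = upSum h' z := by
  unfold upSum
  refine Finset.sum_congr rfl fun ω _ => ?_
  split_ifs with hz
  · exact H ω hz
  · rfl

theorem upSum_nonneg {h : Finset V → ℝ} (z : Finset V) (H : ∀ ω, z ⊆ ω → 0 ≤ h ω) :
    0 ≤ upSum h z := by
  unfold upSum
  refine Finset.sum_nonneg fun ω _ => ?_
  split_ifs with hz
  · exact H ω hz
  · rfl

theorem upSum_mono {h h' : Finset V → ℝ} {z : Finset V} (H : ∀ ω, z ⊆ ω → h ω ≤ h' ω) :
    upSum h z ≤ upSum h' z := by
  unfold upSum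
  refine Finset.sum_le_sum fun ω _ => ?_
  split_ifs with hz
  · exact H ω hz
  · rfl

theorem upSum_add (h h' : Finset V → ℝ) (z : Finset V) :
    upSum (fun ω => h ω + h' ω) z = upSum h z + upSum h' z := by
  simp only [upSum, ← Finset.sum_add_distrib]
  exact Finset.sum_congr rfl fun ω _ => by split_ifs <;> simp

theorem upSum_const_mul (a : ℝ) (h : Finset V → ℝ) (z : Finset V) :
    upSum (fun ω => a * h ω) z = a * upSum h z := by
  simp only [upSum, Finset.mul_sum]
  exact Finset.sum_congr rfl fun ω _ => by split_ifs <;> simp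

theorem upSum_empty (h : Finset V → ℝ) : upSum h ∅ = ∑ ω, h ω := by
  simp [upSum]

theorem sum_compl_upSum_insert_mul (h : Finset V → ℝ) (g : V → ℝ) (z : Finset V) :
    ∑ x ∈ zᶜ, upSum h (insert x z) * g x =
      upSum (fun ω => h ω * ∑ x ∈ ω \ z, g x) z := by
  simp only [upSum, Finset.sum_mul]
  rw [Finset.sum_comm]
  refine Finset.sum_congr rfl fun ω _ => ?_
  split_ifs with hz
  · have : ω \ z = zᶜ.filter (· ∈ ω) := by ext; simp [and_comm]
    rw [this, Finset.mul_sum, Finset.sum_filter]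
    refine Finset.sum_congr rfl fun x _ => ?_
    simp [Finset.insert_subset_iff, hz]
  · refine Finset.sum_eq_zero fun x _ => ?_
    simp [Finset.insert_subset_iff, hz]

theorem sum_compl_upSum_insert {h : Finset V → ℝ} {N : ℕ} (hN : ∀ ω, ω.card ≠ N → h ω = 0)
    (z : Finset V) :
    ∑ x ∈ zᶜ, upSum h (insert x z) = ((N : ℝ) - z.card) * upSum h z := by
  have := sum_compl_upSum_insert_mul h (fun _ => 1) z
  simp only [mul_one] at this
  rw [this, ← upSum_const_mul]
  refine upSum_congr fun ω hω => ?_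
  by_cases hc : ω.card = N
  · simp [Finset.cast_card_sdiff hω, hc, mul_comm]
  · simp [hN ω hc]

theorem sum_upSum_of_card {h : Finset V → ℝ} {N : ℕ} (hN : ∀ ω, ω.card ≠ N → h ω = 0) (ℓ : ℕ) :
    (∑ y : Finset V, if y.card = ℓ then upSum h y else 0) = N.choose ℓ * ∑ ω, h ω := by
  have key : ∀ y : Finset V, (if y.card = ℓ then upSum h y else 0) =
      ∑ ω : Finset V, if y ∈ ω.powersetCard ℓ then h ω else 0 := by
    intro y
    split_ifs with hy <;> simp [upSum, Finset.mem_powersetCard, hy]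
  simp only [key]
  rw [Finset.sum_comm, Finset.mul_sum]
  refine Finset.sum_congr rfl fun ω _ => ?_
  rw [← Finset.sum_filter, Finset.filter_mem_eq_inter, Finset.univ_inter, Finset.sum_const,
    Finset.card_powersetCard, nsmul_eq_mul]
  by_cases hc : ω.card = N
  · rw [hc]
  · simp [hN ω hc]

theorem upSum_mul_sq_le {p : Finset V → ℝ} (hp : ∀ ω, 0 ≤ p ω) (f g : Finset V → ℝ)
    (z : Finset V) :
    upSum (fun ω => p ω * (f ω * g ω)) z ^ 2 ≤
      upSum (fun ω => p ω * f ω ^ 2) z * upSum (fun ω => p ω * g ω ^ 2) z := by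
  unfold upSum
  refine Finset.sum_sq_le_sum_mul_sum_of_sq_le_mul _ ?_ ?_ ?_
  · intro ω _
    have := hp ω
    split_ifs <;> positivity
  · intro ω _
    have := hp ω
    split_ifs <;> positivity
  · intro ω _
    refine le_of_eq ?_
    split_ifs <;> ring

end UpSum

namespace WComplex

variable {V : Type*} [Fintype V] [DecidableEq V] {n : ℕ} (K : WComplex V n)

theorem pi_nonneg (ω : Finset V) : 0 ≤ K.pi ω := by
  by_cases h : ω ∈ K.faces
  · by_cases h' : ω.card = n
    · exact (K.pi_pos ω h h').le
    · exact (K.pi_zero_of_card_ne ω h').ge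
  · exact (K.pi_zero_of_not_mem ω h).ge

theorem mass_eq_upSum (z : Finset V) : K.mass z = upSum K.pi z := rfl

theorem mass_nonneg (z : Finset V) : 0 ≤ K.mass z :=
  upSum_nonneg z fun ω _ => K.pi_nonneg ω

theorem mass_pos {z : Finset V} (hz : z ∈ K.faces) : 0 < K.mass z := by
  obtain ⟨ω, hω, hc, hs⟩ := K.pure z hz
  refine Finset.sum_pos' (fun ω _ => ?_) ⟨ω, Finset.mem_univ _, ?_⟩
  · have := K.pi_nonneg ω
    split_ifs <;> simp [this]
  · rw [if_pos hs]
    exact K.pi_pos ω hω hc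

theorem mass_eq_zero {z : Finset V} (hz : z ∉ K.faces) : K.mass z = 0 := by
  refine Finset.sum_eq_zero fun ω _ => ?_
  split_ifs with h
  · exact K.pi_zero_of_not_mem ω fun hω => hz (K.down_closed ω hω z h)
  · rfl

theorem upSum_pi_mul_eq_zero {z : Finset V} (hz : K.mass z = 0) (h : Finset V → ℝ) :
    upSum (fun ω => K.pi ω * h ω) z = 0 := by
  have hz' : z ∉ K.faces := fun hf => (K.mass_pos hf).ne' hz
  refine Finset.sum_eq_zero fun ω _ => ?_
  split_ifs with hs
  · simp [K.pi_zero_of_not_mem ω fun hω => hz' (K.down_closed ω hω z hs)]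
  · rfl

theorem mass_eq_pi {ω : Finset V} (hω : ω.card = n) : K.mass ω = K.pi ω := by
  unfold mass
  rw [Finset.sum_eq_single ω]
  · simp
  · intro b _ hb
    split_ifs with hs
    · refine K.pi_zero_of_card_ne b fun hc => hb ?_
      exact (Finset.eq_of_subset_of_card_le hs (by omega)).symm
    · rfl
  · simp

theorem empty_mem_faces : ∅ ∈ K.faces := by
  obtain ⟨α, hα⟩ := K.faces_nonempty
  exact K.down_closed α hα ∅ (Finset.empty_subset _)

theorem sum_compl_mass_mul (g : V → ℝ) (z : Finset V) :
    ∑ x ∈ zᶜ, K.mass (insert x z) * g x = upSum (fun ω => K.pi ω * ∑ x ∈ ω \ z, g x) z :=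
  sum_compl_upSum_insert_mul K.pi g z

/-! ### The link random walk as a quadratic form -/

theorem linkMass_singleton (z : Finset V) (x : V) :
    K.linkMass z {x} = if x ∈ z then 0 else K.mass (insert x z) / K.mass z := by
  unfold linkMass linkPi
  split_ifs with hx
  · refine Finset.sum_eq_zero fun β _ => ?_
    split_ifs with h1 h2
    · exact absurd hx (Finset.disjoint_left.mp h2 (Finset.singleton_subset_iff.mp h1))
    · rfl
    · rfl
  · rw [show K.mass (insert x z) = ∑ ω, if insert x z ⊆ ω then K.pi ω else 0 from rfl,
      Finset.sum_div]
    simp only [← ite_and, ite_div, zero_div]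
    rw [← Finset.sum_filter, ← Finset.sum_filter]
    refine Finset.sum_bij' (fun β _ => z ∪ β) (fun ω _ => ω \ z) ?_ ?_ ?_ ?_ ?_
    · intro β hβ
      simp only [Finset.mem_filter, Finset.mem_univ, true_and, Finset.singleton_subset_iff] at hβ ⊢
      exact Finset.insert_subset (Finset.mem_union_right _ hβ.1) Finset.subset_union_left
    · intro ω hω
      simp only [Finset.mem_filter, Finset.mem_univ, true_and, Finset.singleton_subset_iff,
        Finset.insert_subset_iff, Finset.mem_sdiff] at hω ⊢
      exact ⟨⟨hω.1, hx⟩, Finset.sdiff_disjoint⟩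
    · intro β hβ
      simp only [Finset.mem_filter, Finset.mem_univ, true_and] at hβ
      rw [Finset.union_sdiff_cancel_left hβ.2.symm]
    · intro ω hω
      simp only [Finset.mem_filter, Finset.mem_univ, true_and, Finset.insert_subset_iff] at hω
      exact Finset.union_sdiff_of_subset hω.2
    · intro β _
      rfl

theorem linkVertex_eq (z : Finset V) (x : V) :
    K.linkVertex z x =
      if x ∈ z then 0 else K.mass (insert x z) / (K.mass z * ((n - z.card : ℕ) : ℝ)) := by
  simp only [linkVertex, linkLevel, Finset.card_singleton, if_true, Nat.choose_one_right,
    linkMass_singleton]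
  split_ifs
  · simp
  · rw [inv_mul_eq_div, div_div]

theorem linkVertex_nonneg (z : Finset V) (x : V) : 0 ≤ K.linkVertex z x := by
  rw [linkVertex_eq]
  have := K.mass_nonneg z
  have := K.mass_nonneg (insert x z)
  split_ifs <;> positivity

/-- Summation against the vertex marginal of the link. -/
theorem sum_linkVertex_mul {z : Finset V} (hz : z ∈ K.faces) (hc : z.card + 1 ≤ n) (g : V → ℝ) :
    (K.mass z * ((n : ℝ) - z.card)) * ∑ x, K.linkVertex z x * g x =
      ∑ x ∈ zᶜ, K.mass (insert x z) * g x := by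
  have hm := (K.mass_pos hz).ne'
  have hn : ((n : ℝ) - z.card) ≠ 0 := by
    have : (z.card : ℝ) + 1 ≤ n := by exact_mod_cast hc
    linarith
  rw [Finset.mul_sum, Finset.compl_eq_univ_sdiff, Finset.sdiff_eq_filter, Finset.sum_filter]
  refine Finset.sum_congr rfl fun x _ => ?_
  rw [linkVertex_eq, Nat.cast_sub (by omega)]
  by_cases hx : x ∈ z
  · simp [hx]
  · simp only [hx, if_false, not_false_eq_true, if_true]
    field_simp

/-- The quadratic form `g ↦ E_ω (∑_{x ∈ ω \ z} g x)²`, up to normalization. -/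
def linkForm (z : Finset V) (g : V → ℝ) : ℝ :=
  upSum (fun ω => K.pi ω * (∑ x ∈ ω \ z, g x) ^ 2) z

theorem linkForm_nonneg (z : Finset V) (g : V → ℝ) : 0 ≤ K.linkForm z g :=
  upSum_nonneg z fun ω _ => mul_nonneg (K.pi_nonneg ω) (sq_nonneg _)

theorem linkForm_eq_sum (z : Finset V) (g : V → ℝ) :
    K.linkForm z g = ∑ x ∈ zᶜ, g x * ∑ y ∈ zᶜ, K.mass (z ∪ {x, y}) * g y := by
  have h1 : ∀ x ∈ zᶜ, ∑ y ∈ zᶜ, K.mass (z ∪ {x, y}) * g y =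
      upSum (fun ω => K.pi ω * ∑ y ∈ ω \ z, g y) (insert x z) := by
    intro x hx
    have e : ∀ (h : Finset V → ℝ) (y : V), upSum h (z ∪ {x, y}) =
        upSum (fun ω => if x ∈ ω then h ω else 0) (insert y z) := by
      intro h y
      simp only [upSum]
      refine Finset.sum_congr rfl fun ω _ => ?_
      simp only [Finset.union_subset_iff, Finset.insert_subset_iff, Finset.singleton_subset_iff]
      by_cases a : z ⊆ ω <;> by_cases b : x ∈ ω <;> by_cases c : y ∈ ω <;> simp [a, b, c]
    simp only [mass_eq_upSum, e]
    rw [sum_compl_upSum_insert_mul]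
    simp only [upSum]
    refine Finset.sum_congr rfl fun ω _ => ?_
    simp only [Finset.insert_subset_iff]
    by_cases a : z ⊆ ω <;> by_cases b : x ∈ ω <;> simp [a, b]
  rw [Finset.sum_congr rfl fun x hx => by rw [h1 x hx, mul_comm]]
  rw [sum_compl_upSum_insert_mul]
  refine upSum_congr fun ω _ => ?_
  ring

theorem mass_insert_mul_linkMat {z : Finset V} {x : V} (y : V) (hxy : x ≠ y) :
    K.mass (insert x z) * K.linkMat z x y =
      K.mass (z ∪ {x, y}) / ((n : ℝ) - z.card - 1) := by
  have e : z ∪ {x} = insert x z := by rw [Finset.union_comm]; rfl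
  rw [linkMat, if_pos hxy, e]
  by_cases h : insert x z ∈ K.faces
  · have := (K.mass_pos h).ne'
    field_simp
  · have h2 : z ∪ {x, y} ∉ K.faces := fun hf =>
      h (K.down_closed _ hf _ (by intro a; simp; tauto))
    rw [K.mass_eq_zero h, K.mass_eq_zero h2, zero_mul, zero_div]

theorem linkForm_eq {z : Finset V} (hz : z ∈ K.faces) (hc : z.card + 2 ≤ n) {g : V → ℝ}
    (hg : inner' (K.linkVertex z) g (fun _ => 1) = 0) :
    K.linkForm z g = K.mass z * ((n : ℝ) - z.card) *
      (inner' (K.linkVertex z) g g +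
        ((n : ℝ) - z.card - 1) * inner' (K.linkVertex z) g (mApp (K.linkMat z) g)) := by
  have hc' : (z.card : ℝ) + 2 ≤ n := by exact_mod_cast hc
  have hn : (n : ℝ) - z.card - 1 ≠ 0 := by linarith
  have h0 : ∑ x ∈ zᶜ, K.mass (insert x z) * g x = 0 := by
    rw [← K.sum_linkVertex_mul hz (by omega)]
    simp only [inner', mul_one] at hg
    rw [hg, mul_zero]
  rw [mul_add, mul_left_comm]
  simp only [inner']
  rw [K.sum_linkVertex_mul hz (by omega), K.sum_linkVertex_mul hz (by omega), Finset.mul_sum,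
    ← Finset.sum_add_distrib, linkForm_eq_sum]
  have hzero : ∑ x ∈ zᶜ, g x * ∑ y ∈ z, K.mass (z ∪ {x, y}) * g y = 0 := by
    have : ∀ x ∈ zᶜ, g x * ∑ y ∈ z, K.mass (z ∪ {x, y}) * g y =
        (K.mass (insert x z) * g x) * ∑ y ∈ z, g y := by
      intro x _
      rw [mul_comm (K.mass _), mul_assoc]
      congr 1
      rw [Finset.mul_sum]
      refine Finset.sum_congr rfl fun y hy => ?_
      congr 2
      ext a
      simp only [Finset.mem_union, Finset.mem_insert, Finset.mem_singleton]
      constructor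
      · rintro (h | h | rfl) <;> tauto
      · tauto
    rw [Finset.sum_congr rfl this, ← Finset.sum_mul, h0, zero_mul]
  rw [← add_zero (∑ x ∈ zᶜ, g x * ∑ y ∈ zᶜ, K.mass (z ∪ {x, y}) * g y), ← hzero,
    ← Finset.sum_add_distrib]
  refine Finset.sum_congr rfl fun x hx => ?_
  rw [← mul_add, add_comm, Finset.sum_add_sum_compl, ← Finset.add_sum_erase _ _ (Finset.mem_univ x)]
  have hM : mApp (K.linkMat z) g x = ∑ y ∈ Finset.univ.erase x, K.linkMat z x y * g y := by
    rw [mApp, ← Finset.add_sum_erase _ _ (Finset.mem_univ x)]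
    simp [linkMat]
  have hxx : z ∪ {x, x} = insert x z := by ext a; simp
  rw [hM, hxx, mul_add]
  congr 1
  · ring
  · simp only [Finset.mul_sum]
    refine Finset.sum_congr rfl fun y hy => ?_
    have := K.mass_insert_mul_linkMat (z := z) y (Finset.ne_of_mem_erase hy).symm
    rw [show ((n : ℝ) - z.card - 1) * (K.mass (insert x z) * (g x * (K.linkMat z x y * g y))) =
      ((n : ℝ) - z.card - 1) * (K.mass (insert x z) * K.linkMat z x y) * (g x * g y) by ring, this,
      mul_div_cancel₀ _ hn]
    ring

theorem linkForm_le {z : Finset V} (hz : z ∈ K.faces) (hc : z.card + 1 ≤ n) (g : V → ℝ) :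
    K.linkForm z g ≤ ((n : ℝ) - z.card) *
      (K.mass z * ((n : ℝ) - z.card) * inner' (K.linkVertex z) g g) := by
  simp only [inner']
  rw [K.sum_linkVertex_mul hz hc, sum_compl_mass_mul, ← upSum_const_mul]
  refine upSum_mono fun ω hω => ?_
  by_cases hcard : ω.card = n
  · have h := sq_sum_le_card_mul_sum_sq (s := ω \ z) (f := g)
    rw [Finset.cast_card_sdiff hω, hcard] at h
    calc K.pi ω * (∑ x ∈ ω \ z, g x) ^ 2
        ≤ K.pi ω * (((n : ℝ) - z.card) * ∑ x ∈ ω \ z, g x ^ 2) :=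
          mul_le_mul_of_nonneg_left h (K.pi_nonneg ω)
      _ = _ := by simp only [sq]; ring
  · simp [K.pi_zero_of_card_ne ω hcard]

theorem inner_linkMat_le {z : Finset V} (hz : z ∈ K.faces) (hc : z.card + 2 ≤ n) {g : V → ℝ}
    (hg : inner' (K.linkVertex z) g (fun _ => 1) = 0) :
    inner' (K.linkVertex z) g (mApp (K.linkMat z) g) ≤ inner' (K.linkVertex z) g g := by
  have hc' : (z.card : ℝ) + 2 ≤ n := by exact_mod_cast hc
  have h := K.linkForm_le hz (by omega) g
  rw [K.linkForm_eq hz hc hg] at h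
  have hp : 0 < K.mass z * ((n : ℝ) - z.card) :=
    mul_pos (K.mass_pos hz) (by linarith)
  rw [mul_left_comm] at h
  have h2 := le_of_mul_le_mul_left h hp
  have h3 : (0 : ℝ) < (n : ℝ) - z.card - 1 := by linarith
  refine le_of_mul_le_mul_left ?_ h3
  linarith

theorem inner_add_inner_linkMat_nonneg {z : Finset V} (hz : z ∈ K.faces) (hc : z.card + 2 ≤ n)
    {g : V → ℝ} (hg : inner' (K.linkVertex z) g (fun _ => 1) = 0) :
    0 ≤ inner' (K.linkVertex z) g g +
      ((n : ℝ) - z.card - 1) * inner' (K.linkVertex z) g (mApp (K.linkMat z) g) := by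
  have hc' : (z.card : ℝ) + 2 ≤ n := by exact_mod_cast hc
  have h := K.linkForm_nonneg z g
  rw [K.linkForm_eq hz hc hg] at h
  exact nonneg_of_mul_nonneg_right h (mul_pos (K.mass_pos hz) (by linarith))

theorem one_mem_upperBounds_rayleigh_link {z : Finset V} (hz : z ∈ K.faces) (hc : z.card + 2 ≤ n) :
    1 ∈ upperBounds {r | ∃ f : V → ℝ, inner' (K.linkVertex z) f f = 1 ∧
      inner' (K.linkVertex z) f (fun _ => 1) = 0 ∧
      r = inner' (K.linkVertex z) f (mApp (K.linkMat z) f)} := by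
  rintro r ⟨f, h1, h0, rfl⟩
  rw [← h1]
  exact K.inner_linkMat_le hz hc h0

theorem specGap_link_nonneg {z : Finset V} (hz : z ∈ K.faces) (hc : z.card + 2 ≤ n) :
    0 ≤ specGap (K.linkVertex z) (K.linkMat z) :=
  sub_nonneg.mpr (Real.sSup_le (K.one_mem_upperBounds_rayleigh_link hz hc) zero_le_one)

theorem inner_linkMat_le_lambda2 {z : Finset V} (hz : z ∈ K.faces) (hc : z.card + 2 ≤ n)
    {g : V → ℝ} (hg : inner' (K.linkVertex z) g (fun _ => 1) = 0) :
    inner' (K.linkVertex z) g (mApp (K.linkMat z) g) ≤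
      lambda2 (K.linkVertex z) (K.linkMat z) * inner' (K.linkVertex z) g g := by
  set μ := K.linkVertex z with hμ
  have hnn : ∀ x ∈ Finset.univ, 0 ≤ μ x * (g x * g x) := fun x _ =>
    mul_nonneg (K.linkVertex_nonneg z x) (mul_self_nonneg _)
  rcases (Finset.sum_nonneg hnn).eq_or_lt with h | h
  · have h0 := (Finset.sum_eq_zero_iff_of_nonneg hnn).mp h.symm
    have e1 : inner' μ g g = 0 := h.symm
    rw [e1, mul_zero]
    refine (Finset.sum_eq_zero fun x hx => ?_).le
    rcases mul_eq_zero.mp (h0 x hx) with h | h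
    · simp [h]
    · simp [mul_self_eq_zero.mp h]
  · change 0 < inner' μ g g at h
    set s := Real.sqrt (inner' μ g g)
    have hs : 0 < s := Real.sqrt_pos.mpr h
    have hss : s * s = inner' μ g g := Real.mul_self_sqrt h.le
    have hsc : ∀ a b : V → ℝ, inner' μ (fun x => s⁻¹ * a x) b = s⁻¹ * inner' μ a b := by
      intro a b
      simp only [inner', Finset.mul_sum]
      exact Finset.sum_congr rfl fun x _ => by ring
    have hsc' : ∀ a b : V → ℝ, inner' μ a (fun x => s⁻¹ * b x) = s⁻¹ * inner' μ a b := by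
      intro a b
      simp only [inner', Finset.mul_sum]
      exact Finset.sum_congr rfl fun x _ => by ring
    have hM : mApp (K.linkMat z) (fun x => s⁻¹ * g x) =
        fun x => s⁻¹ * mApp (K.linkMat z) g x := by
      funext x
      simp only [mApp, Finset.mul_sum]
      exact Finset.sum_congr rfl fun x _ => by ring
    have := le_csSup ⟨1, K.one_mem_upperBounds_rayleigh_link hz hc⟩
      ⟨fun x => s⁻¹ * g x, by rw [← hμ, hsc, hsc', ← hss]; field_simp,
        by rw [← hμ, hsc, hg, mul_zero], rfl⟩
    rw [← hμ, hM, hsc, hsc'] at this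
    rw [← hss, lambda2]
    calc inner' μ g (mApp (K.linkMat z) g)
        = (s⁻¹ * (s⁻¹ * inner' μ g (mApp (K.linkMat z) g))) * (s * s) := by field_simp
      _ ≤ _ := mul_le_mul_of_nonneg_right this (by positivity)

theorem lambda2_link_ge {z : Finset V} (hz : z ∈ K.faces) (hc : z.card + 2 ≤ n) :
    0 ≤ 1 + ((n : ℝ) - z.card - 1) * lambda2 (K.linkVertex z) (K.linkMat z) := by
  have hc' : (z.card : ℝ) + 2 ≤ n := by exact_mod_cast hc
  obtain ⟨ω, hω, hcard, hs⟩ := K.pure z hz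
  obtain ⟨x, hx, y, hy, hxy⟩ := Finset.one_lt_card.mp
    (show 1 < (ω \ z).card by rw [Finset.card_sdiff_of_subset hs]; omega)
  rw [Finset.mem_sdiff] at hx hy
  have hpos : ∀ a, a ∈ ω ∧ a ∉ z → 0 < K.linkVertex z a := by
    intro a ha
    rw [linkVertex_eq, if_neg ha.2]
    have h1 := K.mass_pos (K.down_closed ω hω (insert a z) (Finset.insert_subset ha.1 hs))
    have h2 := K.mass_pos hz
    have h3 : (0 : ℝ) < ((n - z.card : ℕ) : ℝ) := by
      rw [Nat.cast_pos]; omega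
    positivity
  have hpx := hpos x hx
  have hpy := hpos y hy
  set μ := K.linkVertex z with hμ
  let g : V → ℝ := fun a => if a = x then μ y else if a = y then -μ x else 0
  have hsum : ∀ h : V → ℝ, inner' μ g h = μ x * (μ y * h x) + μ y * (-μ x * h y) := by
    intro h
    rw [inner', Finset.sum_eq_add x y hxy]
    · simp [g, hxy.symm]
    · intro c _ hc
      simp [g, hc.1, hc.2]
    · simp
    · simp
  have hg0 : inner' μ g (fun _ => 1) = 0 := by rw [hsum]; ring
  have hgg : 0 < inner' μ g g := by
    rw [hsum]
    simp only [g, hxy.symm, if_true, if_false]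
    have : 0 < μ x * (μ y * μ y) := by positivity
    have : 0 < μ y * (μ x * μ x) := by positivity
    nlinarith
  have h1 := K.inner_add_inner_linkMat_nonneg hz hc hg0
  have h2 := K.inner_linkMat_le_lambda2 hz hc hg0
  have h3 := mul_le_mul_of_nonneg_left h2 (show (0 : ℝ) ≤ (n : ℝ) - z.card - 1 by linarith)
  refine nonneg_of_mul_nonneg_left ?_ hgg
  rw [← hμ] at h1 h3
  linarith

theorem specGap_link_le {z : Finset V} (hz : z ∈ K.faces) (hc : z.card + 2 ≤ n) :
    specGap (K.linkVertex z) (K.linkMat z) ≤ ((n : ℝ) - z.card) / ((n : ℝ) - z.card - 1) := by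
  have hc' : (z.card : ℝ) + 2 ≤ n := by exact_mod_cast hc
  rw [le_div_iff₀ (by linarith), specGap]
  linarith [K.lambda2_link_ge hz hc]

/-! ### Conditional variances -/

/-- `Pr[ω ⊇ z]` times the variance of `f` conditioned on `ω ⊇ z`. -/
def massVar (f : Finset V → ℝ) (z : Finset V) : ℝ :=
  upSum (fun ω => K.pi ω * f ω ^ 2) z - upSum (fun ω => K.pi ω * f ω) z ^ 2 / K.mass z

theorem massVar_nonneg (f : Finset V → ℝ) (z : Finset V) : 0 ≤ K.massVar f z := by
  have h := upSum_mul_sq_le K.pi_nonneg f (fun _ => 1) z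
  simp only [mul_one, one_pow] at h
  exact sub_nonneg.mpr (div_le_of_le_mul₀ (K.mass_nonneg z)
    (upSum_nonneg z fun ω _ => mul_nonneg (K.pi_nonneg ω) (sq_nonneg _)) h)

theorem massVar_eq_zero (f : Finset V → ℝ) {z : Finset V} (hz : z ∉ K.faces) :
    K.massVar f z = 0 := by
  have h := K.mass_eq_zero hz
  simp [massVar, K.upSum_pi_mul_eq_zero h]

theorem massVar_sub_const (f : Finset V → ℝ) (a : ℝ) (z : Finset V) :
    K.massVar (fun ω => f ω - a) z = K.massVar f z := by
  by_cases h : K.mass z = 0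
  · simp [massVar, K.upSum_pi_mul_eq_zero h]
  · have e1 : upSum (fun ω => K.pi ω * (f ω - a) ^ 2) z =
        upSum (fun ω => K.pi ω * f ω ^ 2) z + ((-2 * a) * upSum (fun ω => K.pi ω * f ω) z +
          a ^ 2 * K.mass z) := by
      rw [mass_eq_upSum, ← upSum_const_mul, ← upSum_const_mul, ← upSum_add, ← upSum_add]
      exact upSum_congr fun ω _ => by ring
    have e2 : upSum (fun ω => K.pi ω * (f ω - a)) z =
        upSum (fun ω => K.pi ω * f ω) z + (-a) * K.mass z := by
      rw [mass_eq_upSum, ← upSum_const_mul, ← upSum_add]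
      exact upSum_congr fun ω _ => by ring
    rw [massVar, massVar, e1, e2]
    field_simp
    ring

theorem specGap_mul_massVar_le {z : Finset V} (hz : z ∈ K.faces) (hc : z.card + 2 ≤ n)
    (f : Finset V → ℝ) :
    ((n : ℝ) - z.card - 1) * specGap (K.linkVertex z) (K.linkMat z) * K.massVar f z ≤
      ∑ x ∈ zᶜ, K.massVar f (insert x z) := by
  wlog hf : upSum (fun ω => K.pi ω * f ω) z = 0 generalizing f
  · have := this (fun ω => f ω - upSum (fun ω => K.pi ω * f ω) z / K.mass z) ?_
    · simpa only [massVar_sub_const] using this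
    · generalize ha : upSum (fun ω => K.pi ω * f ω) z / K.mass z = a
      have e2 : upSum (fun ω => K.pi ω * (f ω - a)) z =
          upSum (fun ω => K.pi ω * f ω) z + (-a) * K.mass z := by
        rw [mass_eq_upSum, ← upSum_const_mul, ← upSum_add]
        exact upSum_congr fun ω _ => by ring
      rw [e2, ← ha]
      have := (K.mass_pos hz).ne'
      field_simp
      ring
  have hc' : (z.card : ℝ) + 2 ≤ n := by exact_mod_cast hc
  set S := upSum (fun ω => K.pi ω * f ω ^ 2) z with hS
  have hS0 : 0 ≤ S := upSum_nonneg z fun ω _ => mul_nonneg (K.pi_nonneg ω) (sq_nonneg _)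
  let g : V → ℝ := fun x => upSum (fun ω => K.pi ω * f ω) (insert x z) / K.mass (insert x z)
  have hmg : ∀ x, K.mass (insert x z) * g x = upSum (fun ω => K.pi ω * f ω) (insert x z) := by
    intro x
    by_cases h : K.mass (insert x z) = 0
    · rw [h, K.upSum_pi_mul_eq_zero h, zero_mul]
    · exact mul_div_cancel₀ _ h
  have hD := K.sum_linkVertex_mul hz (by omega) (fun x => g x * g x)
  change _ * inner' _ g g = _ at hD
  have hg0 : inner' (K.linkVertex z) g (fun _ => 1) = 0 := by
    have h := K.sum_linkVertex_mul hz (by omega) g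
    simp only [hmg] at h
    rw [sum_compl_upSum_insert (N := n) (fun ω hω => by simp [K.pi_zero_of_card_ne ω hω]), hf,
      mul_zero] at h
    simp only [inner', mul_one]
    exact (mul_eq_zero.mp h).resolve_left
      (mul_pos (K.mass_pos hz) (by linarith)).ne'
  set D := ∑ x ∈ zᶜ, K.mass (insert x z) * (g x * g x) with hDdef
  have hD0 : 0 ≤ D := Finset.sum_nonneg fun x _ =>
    mul_nonneg (K.mass_nonneg _) (mul_self_nonneg _)
  have hsum : ∑ x ∈ zᶜ, K.massVar f (insert x z) = ((n : ℝ) - z.card) * S - D := by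
    simp only [massVar]
    rw [Finset.sum_sub_distrib,
      sum_compl_upSum_insert (N := n) (fun ω hω => by simp [K.pi_zero_of_card_ne ω hω])]
    congr 1
    refine Finset.sum_congr rfl fun x _ => ?_
    rw [← mul_assoc, hmg]
    simp only [g]
    ring
  have hDe : D = upSum (fun ω => K.pi ω * (f ω * ∑ x ∈ ω \ z, g x)) z := by
    rw [hDdef]
    simp only [← mul_assoc, hmg]
    exact sum_compl_upSum_insert_mul _ g z
  have hCS : D ^ 2 ≤ S * K.linkForm z g := by
    rw [hDe]
    exact upSum_mul_sq_le K.pi_nonneg f (fun ω => ∑ x ∈ ω \ z, g x) z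
  set lam := lambda2 (K.linkVertex z) (K.linkMat z) with hlam
  have hQ : K.linkForm z g ≤ (1 + ((n : ℝ) - z.card - 1) * lam) * D := by
    rw [K.linkForm_eq hz hc hg0, ← hD]
    have h := K.inner_linkMat_le_lambda2 hz hc hg0
    have h3 := mul_le_mul_of_nonneg_left h (show (0 : ℝ) ≤ (n : ℝ) - z.card - 1 by linarith)
    have h4 : 0 ≤ K.mass z * ((n : ℝ) - z.card) :=
      mul_nonneg (K.mass_nonneg z) (by linarith)
    calc _ ≤ K.mass z * ((n : ℝ) - z.card) * (inner' (K.linkVertex z) g g +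
          ((n : ℝ) - z.card - 1) * (lam * inner' (K.linkVertex z) g g)) :=
          mul_le_mul_of_nonneg_left (by linarith) h4
      _ = _ := by ring
  have hlam0 : 0 ≤ 1 + ((n : ℝ) - z.card - 1) * lam := K.lambda2_link_ge hz hc
  have hmain : D ≤ S * (1 + ((n : ℝ) - z.card - 1) * lam) := by
    rcases hD0.eq_or_lt with h | h
    · rw [← h]; positivity
    · refine le_of_mul_le_mul_right ?_ h
      calc D * D = D ^ 2 := (sq D).symm
        _ ≤ S * K.linkForm z g := hCS
        _ ≤ S * ((1 + ((n : ℝ) - z.card - 1) * lam) * D) := mul_le_mul_of_nonneg_left hQ hS0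
        _ = _ := by ring
  have hv : K.massVar f z = S := by simp [massVar, hf, hS]
  rw [hsum, hv, specGap]
  linarith

/-- The sum of the (unnormalized) conditional variances over the faces of cardinality `ℓ`
containing `z`. -/
def levelVar (f : Finset V → ℝ) (ℓ : ℕ) (z : Finset V) : ℝ :=
  upSum (fun y => if y.card = ℓ then K.massVar f y else 0) z

theorem levelVar_nonneg (f : Finset V → ℝ) (ℓ : ℕ) (z : Finset V) : 0 ≤ K.levelVar f ℓ z := by
  refine upSum_nonneg z fun y _ => ?_
  split_ifs
  · exact K.massVar_nonneg f y
  · rfl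

theorem levelVar_card (f : Finset V → ℝ) (z : Finset V) :
    K.levelVar f z.card z = K.massVar f z := by
  unfold levelVar upSum
  rw [Finset.sum_eq_single z]
  · simp
  · intro b _ hb
    by_cases h1 : z ⊆ b <;> by_cases h2 : b.card = z.card <;> simp only [h1, h2, if_true, if_false]
    exact absurd (Finset.eq_of_subset_of_card_le h1 h2.le).symm hb
  · simp

theorem exists_insert_mem_faces {z : Finset V} (hz : z ∈ K.faces) (hc : z.card < n) :
    ∃ x ∈ zᶜ, insert x z ∈ K.faces := by
  obtain ⟨ω, hω, hcard, hs⟩ := K.pure z hz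
  obtain ⟨x, hx, hxz⟩ := Finset.exists_mem_notMem_of_card_lt_card (hcard ▸ hc)
  exact ⟨x, by simpa using hxz, K.down_closed ω hω _ (Finset.insert_subset hx hs)⟩

/-- Iterating the local spectral gap bound along an optimal chain of faces above `z`. -/
theorem exists_chain_levelVar_ge (f : Finset V → ℝ) {ℓ : ℕ} (hℓ : ℓ + 1 ≤ n) (k : ℕ) :
    ∀ z ∈ K.faces, z.card + k = ℓ → ∃ c : ℕ → Finset V, c 0 = z ∧
      (∀ i < k, c i ∈ K.faces ∧ (c i).card = z.card + i) ∧
      (∀ i, i + 1 < k → c i ⊆ c (i + 1)) ∧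
      ((n - z.card - 1).choose k : ℝ) *
        (∏ i ∈ Finset.range k, specGap (K.linkVertex (c i)) (K.linkMat (c i))) * K.massVar f z ≤
        K.levelVar f ℓ z := by
  induction k with
  | zero =>
    intro z _ hzk
    refine ⟨fun _ => z, rfl, by simp, by simp, ?_⟩
    have : ℓ = z.card := by omega
    rw [this, levelVar_card]
    simp
  | succ k ih =>
    intro z hz hzk
    have hcx : ∀ x ∈ zᶜ, (insert x z).card = z.card + 1 := fun x hx =>
      Finset.card_insert_of_notMem (by simpa using hx)
    let s := zᶜ.filter (fun x => insert x z ∈ K.faces)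
    have hs : s.Nonempty := by
      obtain ⟨x, hx, hf⟩ := K.exists_insert_mem_faces hz (by omega)
      exact ⟨x, Finset.mem_filter.mpr ⟨hx, hf⟩⟩
    have hex : ∀ x : V, ∃ c : ℕ → Finset V, x ∈ s → c 0 = insert x z ∧
        (∀ i < k, c i ∈ K.faces ∧ (c i).card = z.card + 1 + i) ∧
        (∀ i, i + 1 < k → c i ⊆ c (i + 1)) ∧
        ((n - z.card - 2).choose k : ℝ) *
          (∏ i ∈ Finset.range k, specGap (K.linkVertex (c i)) (K.linkMat (c i))) *
            K.massVar f (insert x z) ≤ K.levelVar f ℓ (insert x z) := by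
      intro x
      by_cases hx : x ∈ s
      · obtain ⟨hxz, hxf⟩ := Finset.mem_filter.mp hx
        obtain ⟨c, hc⟩ := ih (insert x z) hxf (by rw [hcx x hxz]; omega)
        rw [hcx x hxz] at hc
        exact ⟨c, fun _ => hc⟩
      · exact ⟨fun _ => ∅, fun h => absurd h hx⟩
    choose c hc using hex
    obtain ⟨x₀, hx₀, hmin⟩ := s.exists_min_image
      (fun x => ∏ i ∈ Finset.range k, specGap (K.linkVertex (c x i)) (K.linkMat (c x i))) hs
    obtain ⟨hc0, hcf, hcs, -⟩ := hc x₀ hx₀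
    set P := ∏ i ∈ Finset.range k, specGap (K.linkVertex (c x₀ i)) (K.linkMat (c x₀ i)) with hP
    have hP0 : 0 ≤ P := Finset.prod_nonneg fun i hi => by
      have hi := Finset.mem_range.mp hi
      refine K.specGap_link_nonneg (hcf i hi).1 ?_
      rw [(hcf i hi).2]
      omega
    refine ⟨fun i => Nat.casesOn i z (c x₀), rfl, ?_, ?_, ?_⟩
    · rintro (_ | i) hi
      · exact ⟨hz, rfl⟩
      · have := hcf i (by omega)
        exact ⟨this.1, by rw [this.2]; omega⟩
    · rintro (_ | i) hi
      · change z ⊆ c x₀ 0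
        rw [hc0]
        exact Finset.subset_insert _ _
      · exact hcs i (by omega)
    · rw [Finset.prod_range_succ']
      change _ * (P * specGap (K.linkVertex z) (K.linkMat z)) * _ ≤ _
      have hrec : ((ℓ : ℝ) - z.card) * K.levelVar f ℓ z =
          ∑ x ∈ zᶜ, K.levelVar f ℓ (insert x z) :=
        (sum_compl_upSum_insert (fun y hy => if_neg hy) z).symm
      have hlk : (ℓ : ℝ) - z.card = k + 1 := by
        rw [← hzk]; push_cast; ring
      rw [hlk] at hrec
      have hterm : ∀ x ∈ zᶜ, ((n - z.card - 2).choose k : ℝ) * P * K.massVar f (insert x z) ≤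
          K.levelVar f ℓ (insert x z) := by
        intro x hx
        by_cases hxf : insert x z ∈ K.faces
        · have hxs : x ∈ s := Finset.mem_filter.mpr ⟨hx, hxf⟩
          refine le_trans ?_ (hc x hxs).2.2.2
          exact mul_le_mul_of_nonneg_right
            (mul_le_mul_of_nonneg_left (hmin x hxs) (Nat.cast_nonneg _)) (K.massVar_nonneg _ _)
        · rw [K.massVar_eq_zero f hxf, mul_zero]
          exact K.levelVar_nonneg _ _ _
      have hsum := Finset.sum_le_sum hterm
      rw [← Finset.mul_sum, ← hrec] at hsum
      have hloc := mul_le_mul_of_nonneg_left (K.specGap_mul_massVar_le hz (by omega) f)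
        (mul_nonneg (Nat.cast_nonneg ((n - z.card - 2).choose k)) hP0)
      have hch : ((n : ℝ) - z.card - 1) * ((n - z.card - 2).choose k : ℝ) =
          ((n - z.card - 1).choose (k + 1) : ℝ) * (k + 1) := by
        have h := Nat.add_one_mul_choose_eq (n - z.card - 2) k
        rw [show n - z.card - 2 + 1 = n - z.card - 1 by omega] at h
        have h' : ((n - z.card - 1 : ℕ) : ℝ) * ((n - z.card - 2).choose k : ℝ) =
          ((n - z.card - 1).choose (k + 1) : ℝ) * (k + 1) := by exact_mod_cast h
        rw [← h', Nat.cast_sub (by omega), Nat.cast_sub (by omega), Nat.cast_one]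
      refine le_of_mul_le_mul_left ?_ (show (0 : ℝ) < k + 1 by positivity)
      refine le_trans (le_of_eq ?_) (hloc.trans hsum)
      linear_combination
        (-(P * specGap (K.linkVertex z) (K.linkMat z) * K.massVar f z)) * hch

/-! ### The down-up walk -/

theorem inner_downUp (ℓ : ℕ) (f : Finset V → ℝ) :
    inner' K.pi f (mApp (K.downUp ℓ) f) = ((n.choose ℓ : ℝ))⁻¹ *
      ∑ y : Finset V, if y.card = ℓ then
        upSum (fun ω => K.pi ω * f ω) y ^ 2 / K.mass y else 0 := by
  have h : ∀ ω ω' : Finset V, K.pi ω * (f ω * (K.downUp ℓ ω ω' * f ω')) =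
      ∑ y : Finset V, if y.card = ℓ then ((n.choose ℓ : ℝ))⁻¹ *
        ((if y ⊆ ω then K.pi ω * f ω else 0) * (if y ⊆ ω' then K.pi ω' * f ω' else 0)
          / K.mass y) else 0 := by
    intro ω ω'
    simp only [downUp, matMul, Finset.sum_mul, Finset.mul_sum]
    refine Finset.sum_congr rfl fun y _ => ?_
    simp only [down, up]
    by_cases hω : ω.card = n
    · by_cases hω' : ω'.card = n
      · rw [K.mass_eq_pi hω']
        by_cases a : y.card = ℓ <;> by_cases b : y ⊆ ω <;> by_cases d : y ⊆ ω' <;>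
          simp [hω, hω', a, b, d]
        ring
      · simp [K.pi_zero_of_card_ne ω' hω', hω']
    · simp [K.pi_zero_of_card_ne ω hω]
  simp only [inner', mApp, Finset.mul_sum]
  rw [Finset.sum_congr rfl fun ω _ => Finset.sum_congr rfl fun ω' _ => h ω ω']
  rw [Finset.sum_congr rfl fun ω _ => Finset.sum_comm, Finset.sum_comm]
  refine Finset.sum_congr rfl fun y _ => ?_
  split_ifs with hy
  · rw [sq, upSum, Finset.sum_mul_sum, Finset.sum_div, Finset.mul_sum]
    refine Finset.sum_congr rfl fun ω _ => ?_
    rw [Finset.sum_div, Finset.mul_sum]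
  · simp

theorem inner_downUp_eq {ℓ : ℕ} (hℓ : ℓ ≤ n) (f : Finset V → ℝ) :
    inner' K.pi f (mApp (K.downUp ℓ) f) =
      inner' K.pi f f - ((n.choose ℓ : ℝ))⁻¹ * K.levelVar f ℓ ∅ := by
  have hS := sum_upSum_of_card (h := fun ω => K.pi ω * f ω ^ 2) (N := n)
    (fun ω hω => by simp [K.pi_zero_of_card_ne ω hω]) ℓ
  have hch : (n.choose ℓ : ℝ) ≠ 0 := by exact_mod_cast (Nat.choose_pos hℓ).ne'
  have hW : K.levelVar f ℓ ∅ =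
      (n.choose ℓ : ℝ) * inner' K.pi f f - ∑ y : Finset V, if y.card = ℓ then
        upSum (fun ω => K.pi ω * f ω) y ^ 2 / K.mass y else 0 := by
    have e : inner' K.pi f f = ∑ ω, K.pi ω * f ω ^ 2 := by simp only [inner', sq]
    rw [e, ← hS, ← Finset.sum_sub_distrib, levelVar, upSum_empty]
    refine Finset.sum_congr rfl fun y _ => ?_
    split_ifs <;> simp [massVar]
  rw [inner_downUp, hW]
  field_simp
  ring

theorem prod_specGap_link_le {ℓ : ℕ} (hℓ : ℓ + 1 ≤ n) {c : ℕ → Finset V}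
    (hc : ∀ i < ℓ, c i ∈ K.faces ∧ (c i).card = i) :
    ∏ i ∈ Finset.range ℓ, specGap (K.linkVertex (c i)) (K.linkMat (c i)) ≤
      (n : ℝ) / ((n : ℝ) - ℓ) := by
  induction ℓ with
  | zero =>
    have : (n : ℝ) ≠ 0 := by exact_mod_cast (by omega : n ≠ 0)
    simp [this]
  | succ k ih =>
    have hk : (k : ℝ) + 1 + 1 ≤ n := by exact_mod_cast hℓ
    obtain ⟨hf, hcard⟩ := hc k (by omega)
    have h := K.specGap_link_le hf (by omega)
    rw [hcard] at h
    rw [Finset.prod_range_succ]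
    calc _ ≤ (n : ℝ) / ((n : ℝ) - k) * (((n : ℝ) - k) / ((n : ℝ) - k - 1)) :=
          mul_le_mul (ih (by omega) fun i hi => hc i (by omega)) h
            (K.specGap_link_nonneg hf (by omega)) (div_nonneg (by positivity) (by linarith))
      _ = _ := by
          have h1 : (n : ℝ) - k ≠ 0 := by linarith
          rw [div_mul_div_cancel₀ h1]
          push_cast
          ring

theorem specGap_downUp_ge_of_chain {ℓ : ℕ} (hℓ : ℓ + 1 ≤ n) {γ : ℝ}
    (hγ : ∀ c : ℕ → Finset V, c 0 = ∅ →
      (∀ i, i < ℓ → c i ∈ K.faces ∧ (c i).card = i) →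
      (∀ i, i + 1 < ℓ → c i ⊆ c (i + 1)) →
      γ ≤ ∏ i ∈ Finset.range ℓ, specGap (K.linkVertex (c i)) (K.linkMat (c i))) :
    (((n : ℝ) - ℓ) / n) * γ ≤ specGap K.pi (K.downUp ℓ) := by
  have hℓ' : (ℓ : ℝ) + 1 ≤ n := by exact_mod_cast hℓ
  have hn : (0 : ℝ) < n := by have : (0 : ℝ) ≤ ℓ := Nat.cast_nonneg ℓ; linarith
  have hcoef : (0 : ℝ) ≤ ((n : ℝ) - ℓ) / n := div_nonneg (by linarith) hn.le
  have hchain : ∀ f : Finset V → ℝ, γ ≤ (n : ℝ) / ((n : ℝ) - ℓ) ∧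
      ((n - 1).choose ℓ : ℝ) * γ * K.massVar f ∅ ≤ K.levelVar f ℓ ∅ := by
    intro f
    obtain ⟨c, h0, hf, hs, hle⟩ :=
      K.exists_chain_levelVar_ge f hℓ ℓ ∅ K.empty_mem_faces (by simp)
    simp only [Finset.card_empty, zero_add, Nat.sub_zero] at hf hle
    have hg := hγ c h0 hf hs
    refine ⟨hg.trans (K.prod_specGap_link_le hℓ hf), le_trans ?_ hle⟩
    exact mul_le_mul_of_nonneg_right (mul_le_mul_of_nonneg_left hg (Nat.cast_nonneg _))
      (K.massVar_nonneg _ _)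
  have hratio : ((n : ℝ) - ℓ) / n = ((n.choose ℓ : ℝ))⁻¹ * ((n - 1).choose ℓ : ℝ) := by
    have hch : (n.choose ℓ : ℝ) ≠ 0 := by exact_mod_cast (Nat.choose_pos (by omega)).ne'
    have h := Nat.choose_mul_succ_eq (n - 1) ℓ
    rw [show n - 1 + 1 = n by omega] at h
    have h' : ((n - 1).choose ℓ : ℝ) * n = (n.choose ℓ : ℝ) * ((n : ℝ) - ℓ) := by
      rw [← Nat.cast_sub (by omega)]
      exact_mod_cast h
    field_simp
    linarith
  rw [specGap, le_sub_comm]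
  refine Real.sSup_le ?_ ?_
  · rintro r ⟨f, h1, h0, rfl⟩
    rw [K.inner_downUp_eq (by omega), h1, hratio]
    have hv : K.massVar f ∅ = 1 := by
      simp only [inner', mul_one] at h0 h1
      simp only [massVar, upSum_empty, h0, sq, h1]
      simp
    have h := (hchain f).2
    rw [hv, mul_one] at h
    have h2 := mul_le_mul_of_nonneg_left h
      (inv_nonneg.mpr (Nat.cast_nonneg (n.choose ℓ) : (0 : ℝ) ≤ _))
    linarith
  · have h := mul_le_mul_of_nonneg_left (hchain 0).1 hcoef
    rw [div_mul_div_cancel₀ hn.ne', div_self (by linarith : (n : ℝ) - ℓ ≠ 0)] at h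
    linarith

end WComplex

end Expanderized

open Expanderized WComplex in
/-- `Gap(Duw_{n↔ℓ})` is at least `((n−ℓ)/n)` times the minimum over
all chains `∅ = ω^(0) ⊊ ⋯ ⊊ ω^(ℓ−1)` with `ω^(i) ∈ X^(i)` of
`∏_{i<ℓ} Gap(M_{ω^(i)})`; in particular
`Gap(Duw_{n↔ℓ}) ≥ ((n−ℓ)/n)·∏_{i<ℓ} Gap_i(X, π)` where
`Gap_i(X, π) = min_{ω̂ ∈ X^(i)} Gap(M_ω̂)`. -/
theorem statement8 {V : Type*} [Fintype V] [DecidableEq V] {n ℓ : ℕ}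
    (K : WComplex V n) (hℓ : ℓ + 1 ≤ n) :
    (∀ γ : ℝ,
        (∀ c : ℕ → Finset V, c 0 = ∅ →
            (∀ i, i < ℓ → c i ∈ K.faces ∧ (c i).card = i) →
            (∀ i, i + 1 < ℓ → c i ⊆ c (i + 1)) →
            γ ≤ ∏ i ∈ Finset.range ℓ, specGap (K.linkVertex (c i)) (K.linkMat (c i))) →
        (((n : ℝ) - ℓ) / n) * γ ≤ specGap K.pi (K.downUp ℓ)) ∧
      (((n : ℝ) - ℓ) / n) *
          ∏ i ∈ Finset.range ℓ,
            sInf {r | ∃ z ∈ K.faces, z.card = i ∧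
                r = specGap (K.linkVertex z) (K.linkMat z)} ≤
        specGap K.pi (K.downUp ℓ) := by
  refine ⟨fun γ hγ => K.specGap_downUp_ge_of_chain hℓ hγ,
    K.specGap_downUp_ge_of_chain hℓ fun c _ hc _ => ?_⟩
  have hnn : ∀ i < ℓ, ∀ r ∈ {r | ∃ z ∈ K.faces, z.card = i ∧
      r = specGap (K.linkVertex z) (K.linkMat z)}, 0 ≤ r := by
    rintro i hi r ⟨z, hz, hcard, rfl⟩
    exact K.specGap_link_nonneg hz (by omega)
  refine Finset.prod_le_prod (fun i hi => ?_) fun i hi => ?_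
  · exact Real.sInf_nonneg (hnn i (Finset.mem_range.mp hi))
  · have hi := Finset.mem_range.mp hi
    exact csInf_le ⟨0, hnn i hi⟩ ⟨c i, (hc i hi).1, (hc i hi).2, rfl⟩
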